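/- arXiv:1410.5449 — 2 statements merged into one kernel-verified Lean document; each statement's English description precedes it below -/
import Mathlib

section
/- In the face lattice of a convex polytope, for any faces p ≤ q, the Möbius function satisfies μ(p, q) = (-1)^{dim q - dim p}. -/
open scoped Classical

/-- `μ` satisfies the defining recursion of the Möbius function of a finite poset. -/
def IsMobius {P : Type*} [PartialOrder P] [Fintype P] (μ : P → P → ℤ) : Prop :=
  (∀ p : P, μ p p = 1) ∧
  (∀ p q : P, p < q → μ p q = -∑ s : P, if p ≤ s ∧ s < q then μ p s else 0) ∧
  (∀ p q : P, ¬p ≤ q → μ p q = 0)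

/-- The Möbius polynomial of a finite ranked poset, evaluated at `z`. -/
noncomputable def mobiusPoly {P : Type*} [PartialOrder P] [Fintype P]
    (μ : P → P → ℤ) (rk : P → ℤ) (z : ℝ) : ℝ :=
  ∑ p : P, ∑ q : P, if p ≤ q then (μ p q : ℝ) * z ^ (rk q - rk p) else 0

/-- A convex polytope: the convex hull of finitely many points. -/
def IsPolytope {n : ℕ} (P : Set (EuclideanSpace ℝ (Fin n))) : Prop :=
  ∃ V : Finset (EuclideanSpace ℝ (Fin n)), P = convexHull ℝ ↑V

/-- The face lattice of `P`: its exposed faces (including `∅` and `P`), ordered by inclusion. -/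
abbrev Faces {n : ℕ} (P : Set (EuclideanSpace ℝ (Fin n))) : Type _ :=
  {F : Set (EuclideanSpace ℝ (Fin n)) // IsExposed ℝ P F}

/-- The dimension of a face: `-1` for the empty face, else the dimension of its affine span. -/
noncomputable def fdim {n : ℕ} (F : Set (EuclideanSpace ℝ (Fin n))) : ℤ :=
  if F = ∅ then -1 else (Module.finrank ℝ (affineSpan ℝ F).direction : ℤ)

section RelOpen

variable {W : Type*} [AddCommGroup W] [Module ℝ W]

/-- Relatively open convex sets (algebraic version). -/
def RO (A : Set W) : Prop :=
  Convex ℝ A ∧ ∀ x ∈ A, ∀ y ∈ A, ∃ ε : ℝ, 0 < ε ∧ x + ε • (x - y) ∈ A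

/-- The signed dimension of a set. -/
noncomputable def eul (A : Set W) : ℝ :=
  if A = ∅ then 0 else (-1 : ℝ) ^ (Module.finrank ℝ (vectorSpan ℝ A))

theorem conv_shrink {A : Set W} (hA : Convex ℝ A) {x v : W} {ε δ : ℝ} (hx : x ∈ A)
    (h : x + ε • v ∈ A) (hδ : 0 ≤ δ) (hε : 0 < ε) (hle : δ ≤ ε) : x + δ • v ∈ A := by
  have := hA.add_smul_mem hx h (t := δ / ε) ⟨by positivity, by rw [div_le_one hε]; exact hle⟩
  rwa [smul_smul, div_mul_cancel₀ _ hε.ne'] at this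

theorem RO.inter {A B : Set W} (hA : RO A) (hB : RO B) : RO (A ∩ B) := by
  refine ⟨hA.1.inter hB.1, ?_⟩
  rintro x ⟨hx, hx'⟩ y ⟨hy, hy'⟩
  obtain ⟨ε, he, h1⟩ := hA.2 x hx y hy
  obtain ⟨δ, hd, h2⟩ := hB.2 x hx' y hy'
  refine ⟨min ε δ, lt_min he hd, conv_shrink hA.1 hx h1 (lt_min he hd).le he (min_le_left _ _),
    conv_shrink hB.1 hx' h2 (lt_min he hd).le hd (min_le_right _ _)⟩

theorem RO.univ : RO (Set.univ : Set W) := ⟨convex_univ, fun _ _ _ _ => ⟨1, one_pos, trivial⟩⟩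

theorem RO.submodule (B : Submodule ℝ W) : RO (B : Set W) :=
  ⟨B.convex, fun _ hx _ hy => ⟨1, one_pos,
    B.add_mem hx (B.smul_mem _ (B.sub_mem hx hy))⟩⟩

theorem RO.zero (f : Module.Dual ℝ W) : RO {x : W | f x = 0} := by
  have := RO.submodule (LinearMap.ker f)
  convert this using 1
  ext x; simp

theorem RO.pos (f : Module.Dual ℝ W) : RO {x : W | 0 < f x} := by
  refine ⟨convex_halfSpace_gt f.isLinear 0, ?_⟩
  intro x hx y hy
  simp only [Set.mem_ofPred_eq] at *
  refine ⟨f x / (f y + f x), by positivity, ?_⟩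
  simp only [map_add, map_smul, map_sub, smul_eq_mul]
  have : f x + f x / (f y + f x) * (f x - f y) = 2 * (f x)^2 / (f y + f x) := by
    field_simp; ring
  rw [this]; positivity

theorem RO.neg (f : Module.Dual ℝ W) : RO {x : W | f x < 0} := by
  have := RO.pos (-f)
  simpa using this

theorem RO.iInter {ι : Type*} (s : Finset ι) (A : ι → Set W) (h : ∀ i ∈ s, RO (A i)) :
    RO (⋂ i ∈ s, A i) := by
  induction s using Finset.induction_on with
  | empty => simpa using RO.univ
  | insert a s ha ih =>
    rw [Finset.set_biInter_insert]
    exact (h a (by simp)).inter (ih fun i hi => h i (by simp [hi]))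

theorem RO.dir {A : Set W} (hA : RO A) {x v : W} (hx : x ∈ A) (hv : v ∈ vectorSpan ℝ A) :
    ∃ ε : ℝ, 0 < ε ∧ x + ε • v ∈ A ∧ x + ε • (-v) ∈ A := by
  rw [vectorSpan_eq_span_vsub_set_right ℝ hx] at hv
  induction hv using Submodule.span_induction with
  | mem v hv =>
    obtain ⟨y, hy, rfl⟩ := hv
    obtain ⟨ε, he, h⟩ := hA.2 x hx y hy
    refine ⟨min 1 ε, lt_min one_pos he, ?_, ?_⟩
    · refine conv_shrink hA.1 hx (ε := 1) ?_ (lt_min one_pos he).le one_pos (min_le_left _ _)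
      simpa using hy
    · refine conv_shrink hA.1 hx (ε := ε) ?_ (lt_min one_pos he).le he (min_le_right _ _)
      simpa using h
  | zero => exact ⟨1, one_pos, by simpa using hx, by simpa using hx⟩
  | add u v _ _ hu hv =>
    obtain ⟨ε, he, h1, h2⟩ := hu
    obtain ⟨δ, hd, h3, h4⟩ := hv
    have hm : 0 < min ε δ := lt_min he hd
    have key : ∀ u v : W, x + ε • u ∈ A → x + δ • v ∈ A →
        x + (min ε δ / 2) • (u + v) ∈ A := by
      intro u v h1 h3
      have a := conv_shrink hA.1 hx h1 hm.le he (min_le_left _ _)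
      have b := conv_shrink hA.1 hx h3 hm.le hd (min_le_right _ _)
      have := hA.1 a b (show (0:ℝ) ≤ 1/2 by norm_num) (show (0:ℝ) ≤ 1/2 by norm_num) (by norm_num)
      convert this using 1
      module
    refine ⟨min ε δ / 2, by positivity, key u v h1 h3, ?_⟩
    rw [neg_add]; exact key _ _ h2 h4
  | smul c v _ hv =>
    obtain ⟨ε, he, h1, h2⟩ := hv
    rcases lt_trichotomy c 0 with hc | hc | hc
    · refine ⟨ε / (-c), div_pos he (by linarith), ?_, ?_⟩
      · convert h2 using 2
        rw [smul_smul, smul_neg, ← neg_smul]; congr 1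
        have := hc.ne; field_simp
      · convert h1 using 2
        rw [smul_neg, smul_smul, ← neg_smul]; congr 1
        have := hc.ne; field_simp
    · subst hc
      exact ⟨1, one_pos, by simpa using hx, by simpa using hx⟩
    · refine ⟨ε / c, div_pos he hc, ?_, ?_⟩
      · convert h1 using 2
        rw [smul_smul]; congr 1
        field_simp
      · convert h2 using 2
        rw [smul_neg, smul_smul, smul_neg]; congr 2
        field_simp

theorem mem_vectorSpan_of {A : Set W} {x v : W} {ε : ℝ} (hε : 0 < ε) (hx : x ∈ A)
    (h : x + ε • v ∈ A) : v ∈ vectorSpan ℝ A := by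
  have := vsub_mem_vectorSpan ℝ h hx
  simp only [vsub_eq_sub, add_sub_cancel_left] at this
  have := (vectorSpan ℝ A).smul_mem ε⁻¹ this
  rwa [smul_smul, inv_mul_cancel₀ hε.ne', one_smul] at this

theorem small_pos (a b : ℝ) (ha : 0 < a) : ∃ δ : ℝ, 0 < δ ∧ δ ≤ 1 ∧ 0 < a + δ * b := by
  refine ⟨a / (a + |b|), by positivity, ?_, ?_⟩
  · rw [div_le_one (by positivity)]; linarith [abs_nonneg b]
  · have h : 0 < a + |b| := by positivity
    have : a + a / (a + |b|) * b = a * (a + (|b| + b)) / (a + |b|) := by field_simp; ring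
    rw [this]
    have := neg_abs_le b
    have : 0 < a + (|b| + b) := by linarith
    positivity

theorem vectorSpan_pos {A : Set W} (hA : Convex ℝ A) (f : Module.Dual ℝ W)
    (hne : (A ∩ {x | 0 < f x}).Nonempty) :
    vectorSpan ℝ (A ∩ {x | 0 < f x}) = vectorSpan ℝ A := by
  apply le_antisymm (vectorSpan_mono ℝ Set.inter_subset_left)
  obtain ⟨x, hx, hfx⟩ := hne
  rw [vectorSpan_eq_span_vsub_set_right ℝ hx, Submodule.span_le]
  rintro _ ⟨y, hy, rfl⟩
  obtain ⟨δ, h0, h1, h2⟩ := small_pos (f x) (f (y - x)) hfx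
  refine mem_vectorSpan_of h0 (x := x) ⟨hx, hfx⟩ ⟨?_, ?_⟩
  · exact conv_shrink hA hx (ε := 1) (by simpa using hy) h0.le one_pos h1
  · simpa using h2

theorem vectorSpan_neg {A : Set W} (hA : Convex ℝ A) (f : Module.Dual ℝ W)
    (hne : (A ∩ {x | f x < 0}).Nonempty) :
    vectorSpan ℝ (A ∩ {x | f x < 0}) = vectorSpan ℝ A := by
  have := vectorSpan_pos hA (-f)
  simp only [LinearMap.neg_apply, Left.neg_pos_iff] at this
  exact this hne

theorem vectorSpan_zero {A : Set W} (hA : RO A) (f : Module.Dual ℝ W)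
    (hne : (A ∩ {x | f x = 0}).Nonempty) :
    vectorSpan ℝ (A ∩ {x | f x = 0}) = vectorSpan ℝ A ⊓ LinearMap.ker f := by
  obtain ⟨x, hx, hfx⟩ := hne
  simp only [Set.mem_ofPred_eq] at hfx
  apply le_antisymm
  · rw [vectorSpan_eq_span_vsub_set_right ℝ (show x ∈ A ∩ {x | f x = 0} from ⟨hx, hfx⟩),
      Submodule.span_le]
    rintro _ ⟨y, ⟨hy, hfy⟩, rfl⟩
    simp only [Set.mem_ofPred_eq] at hfy
    exact ⟨vsub_mem_vectorSpan ℝ hy hx, by simp [hfx, hfy]⟩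
  · rintro v ⟨hv, hfv⟩
    obtain ⟨ε, he, h, _⟩ := hA.dir hx hv
    have hfv : f v = 0 := hfv
    exact mem_vectorSpan_of he (x := x) ⟨hx, hfx⟩ ⟨h, by simp [hfx, hfv]⟩

theorem eul_empty : eul (∅ : Set W) = 0 := by simp [eul]

theorem eul_congr {A B : Set W} (hA : A.Nonempty) (hB : B.Nonempty)
    (h : vectorSpan ℝ A = vectorSpan ℝ B) : eul A = eul B := by
  rw [eul, eul, if_neg hA.ne_empty, if_neg hB.ne_empty, h]

theorem exists_zero {A : Set W} (hA : Convex ℝ A) (f : Module.Dual ℝ W)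
    (hp : (A ∩ {x | 0 < f x}).Nonempty) (hn : (A ∩ {x | f x < 0}).Nonempty) :
    (A ∩ {x | f x = 0}).Nonempty := by
  obtain ⟨x, hx, hfx⟩ := hp
  obtain ⟨y, hy, hfy⟩ := hn
  simp only [Set.mem_ofPred_eq] at hfx hfy
  have hd : 0 < f x - f y := by linarith
  refine ⟨(-f y / (f x - f y)) • x + (f x / (f x - f y)) • y, hA hx hy ?_ ?_ ?_, ?_⟩
  · exact div_nonneg (by linarith) hd.le
  · exact div_nonneg (by linarith) hd.le
  · field_simp; ring
  · simp only [Set.mem_ofPred_eq, map_add, map_smul, smul_eq_mul]; field_simp; ring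

variable [FiniteDimensional ℝ W]

theorem finrank_inf_ker (U : Submodule ℝ W) (f : Module.Dual ℝ W) {u : W} (hu : u ∈ U)
    (hf : f u ≠ 0) : Module.finrank ℝ U = Module.finrank ℝ (U ⊓ LinearMap.ker f : Submodule ℝ W) + 1 := by
  have h1 := (f.domRestrict U).finrank_range_add_finrank_ker
  have h2 : Module.finrank ℝ (LinearMap.range (f.domRestrict U)) = 1 := by
    have : LinearMap.range (f.domRestrict U) = ⊤ := by
      apply LinearMap.range_eq_top.2
      apply LinearMap.surjective
      intro h
      exact hf (by simpa using congrArg (fun g => g ⟨u, hu⟩) h)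
    rw [this]; simp
  have h3 : (LinearMap.ker (f.domRestrict U)).map U.subtype = U ⊓ LinearMap.ker f := by
    ext x; simp [Submodule.mem_map, and_comm]
  rw [← h3, Submodule.finrank_map_subtype_eq]
  omega

/-- If both signs occur, the hyperplane section has opposite sign. -/
theorem eul_section {A : Set W} (hA : RO A) (f : Module.Dual ℝ W)
    (hp : (A ∩ {x | 0 < f x}).Nonempty) (hn : (A ∩ {x | f x < 0}).Nonempty) :
    eul (A ∩ {x | f x = 0}) = - eul A := by
  have h0 := exists_zero hA.1 f hp hn
  have hAne : A.Nonempty := hp.mono Set.inter_subset_left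
  rw [eul, eul, if_neg h0.ne_empty, if_neg hAne.ne_empty, vectorSpan_zero hA f h0]
  obtain ⟨x, hx, hfx⟩ := hp
  obtain ⟨y, hy, hfy⟩ := hn
  simp only [Set.mem_ofPred_eq] at hfx hfy
  rw [finrank_inf_ker (vectorSpan ℝ A) f (vsub_mem_vectorSpan ℝ hx hy)
    (by simp; linarith), pow_succ]
  ring

theorem eul_split {A : Set W} (hA : RO A) (f : Module.Dual ℝ W) :
    eul A = eul (A ∩ {x | f x < 0}) + eul (A ∩ {x | f x = 0}) + eul (A ∩ {x | 0 < f x}) := by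
  rcases Set.eq_empty_or_nonempty A with rfl | hne
  · simp [eul_empty]
  by_cases hp : (A ∩ {x | 0 < f x}).Nonempty
  · by_cases hn : (A ∩ {x | f x < 0}).Nonempty
    · rw [eul_section hA f hp hn, eul_congr hp hne (vectorSpan_pos hA.1 f hp),
        eul_congr hn hne (vectorSpan_neg hA.1 f hn)]
      ring
    · have hz : A ∩ {x | f x = 0} = ∅ := by
        by_contra h
        obtain ⟨x, hx, hfx⟩ := Set.nonempty_iff_ne_empty.2 h
        obtain ⟨y, hy, hfy⟩ := hp
        simp only [Set.mem_ofPred_eq] at hfx hfy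
        obtain ⟨ε, he, h⟩ := hA.2 x hx y hy
        exact hn ⟨_, h, by simp [hfx]; positivity⟩
      rw [Set.not_nonempty_iff_eq_empty.1 hn, hz, eul_congr hp hne (vectorSpan_pos hA.1 f hp)]
      simp [eul_empty]
  · by_cases hn : (A ∩ {x | f x < 0}).Nonempty
    · have hz : A ∩ {x | f x = 0} = ∅ := by
        by_contra h
        obtain ⟨x, hx, hfx⟩ := Set.nonempty_iff_ne_empty.2 h
        obtain ⟨y, hy, hfy⟩ := hn
        simp only [Set.mem_ofPred_eq] at hfx hfy
        obtain ⟨ε, he, h⟩ := hA.2 x hx y hy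
        exact hp ⟨_, h, by simp [hfx]; nlinarith⟩
      rw [Set.not_nonempty_iff_eq_empty.1 hp, hz, eul_congr hn hne (vectorSpan_neg hA.1 f hn)]
      simp [eul_empty]
    · have : A ∩ {x | f x = 0} = A := by
        refine Set.inter_eq_left.2 fun x hx => ?_
        rcases lt_trichotomy (f x) 0 with h | h | h
        · exact absurd ⟨x, hx, h⟩ hn
        · exact h
        · exact absurd ⟨x, hx, h⟩ hp
      rw [this, Set.not_nonempty_iff_eq_empty.1 hp, Set.not_nonempty_iff_eq_empty.1 hn]
      simp [eul_empty]

theorem eul_partition {τ : Type*} (T : Finset τ) (D : τ → Set W) (hD : ∀ S ∈ T, RO (D S))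
    (L : List (Module.Dual ℝ W)) : ∀ (A : Set W), RO A →
    (∀ x ∈ A, ∃ S ∈ T, x ∈ D S) →
    (∀ x ∈ A, ∀ S ∈ T, ∀ S' ∈ T, x ∈ D S → x ∈ D S' → S = S') →
    (∀ S ∈ T, ∀ x ∈ A, ∀ y ∈ A, (∀ h ∈ L, SignType.sign (h x) = SignType.sign (h y)) →
      x ∈ D S → y ∈ D S) → ∑ S ∈ T, eul (A ∩ D S) = eul A := by
  induction L with
  | nil =>
    intro A hA hex huniq hdet
    rcases Set.eq_empty_or_nonempty A with rfl | ⟨x, hx⟩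
    · simp [eul_empty]
    obtain ⟨S, hS, hxS⟩ := hex x hx
    have hall : ∀ y ∈ A, y ∈ D S := fun y hy => hdet S hS x hx y hy (by simp) hxS
    rw [Finset.sum_eq_single_of_mem S hS, Set.inter_eq_left.2 hall]
    intro S' hS' hne
    have : A ∩ D S' = ∅ := by
      by_contra h
      obtain ⟨y, hy, hyS⟩ := Set.nonempty_iff_ne_empty.2 h
      exact hne (huniq y hy S' hS' S hS hyS (hall y hy))
    rw [this, eul_empty]
  | cons f L ih =>
    intro A hA hex huniq hdet
    have sub : ∀ B : Set W, RO B →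
        (∀ x ∈ B, ∀ y ∈ B, SignType.sign (f x) = SignType.sign (f y)) →
        ∑ S ∈ T, eul (A ∩ B ∩ D S) = eul (A ∩ B) := by
      intro B hB hs
      apply ih _ (hA.inter hB)
      · exact fun x hx => hex x hx.1
      · exact fun x hx => huniq x hx.1
      · intro S hS x hx y hy h hxS
        refine hdet S hS x hx.1 y hy.1 ?_ hxS
        intro g hg
        rcases List.mem_cons.1 hg with rfl | hg
        · exact hs x hx.2 y hy.2
        · exact h g hg
    rw [eul_split hA f, ← sub _ (RO.neg f) (by
        intro x hx y hy; rw [sign_neg hx, sign_neg hy]),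
      ← sub _ (RO.zero f) (by
        intro x hx y hy
        simp only [Set.mem_ofPred_eq] at hx hy
        rw [hx, hy]),
      ← sub _ (RO.pos f) (by
        intro x hx y hy; rw [sign_pos hx, sign_pos hy]),
      ← Finset.sum_add_distrib, ← Finset.sum_add_distrib]
    refine Finset.sum_congr rfl fun S hS => ?_
    rw [eul_split (hA.inter (hD S hS)) f]
    simp only [Set.inter_right_comm]

end RelOpen
section Cone

variable {W : Type*} [AddCommGroup W] [Module ℝ W]

theorem vectorSpan_submodule (B : Submodule ℝ W) : vectorSpan ℝ (B : Set W) = B := by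
  rw [vectorSpan_eq_span_vsub_set_right ℝ (show (0 : W) ∈ (B : Set W) from B.zero_mem)]
  simp

theorem vectorSpan_open {ι : Type*} (K : Finset ι) (a : ι → Module.Dual ℝ W) {A : Set W}
    (hA : RO A) (hne : (A ∩ {g | ∀ j ∈ K, 0 < a j g}).Nonempty) :
    RO (A ∩ {g | ∀ j ∈ K, 0 < a j g}) ∧
    vectorSpan ℝ (A ∩ {g | ∀ j ∈ K, 0 < a j g}) = vectorSpan ℝ A := by
  induction K using Finset.induction_on with
  | empty => simpa using hA
  | insert k K hk ih =>
    have e : A ∩ {g | ∀ j ∈ insert k K, 0 < a j g} =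
        (A ∩ {g | ∀ j ∈ K, 0 < a j g}) ∩ {g | 0 < a k g} := by
      ext g; simp; tauto
    rw [e] at hne ⊢
    obtain ⟨h1, h2⟩ := ih (hne.mono Set.inter_subset_left)
    exact ⟨h1.inter (RO.pos _), by rw [vectorSpan_pos h1.1 _ hne, h2]⟩

/-- The cell of the cone with vanishing set `S`. -/
def cell {ι : Type*} (J : Finset ι) (a : ι → Module.Dual ℝ W) (W0 : Submodule ℝ W)
    (S : Finset ι) : Set W :=
  {g | g ∈ W0 ∧ (∀ j ∈ S, a j g = 0) ∧ ∀ j ∈ J, j ∉ S → 0 < a j g}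

/-- The argmin cell. -/
def dcell {ι : Type*} (J : Finset ι) (f : ι → Module.Dual ℝ W) (W0 : Submodule ℝ W)
    (S : Finset ι) : Set W :=
  {g | g ∈ W0 ∧ (∀ i ∈ S, ∀ j ∈ S, f i g = f j g) ∧ ∀ i ∈ S, ∀ j ∈ J, j ∉ S → f i g < f j g}

theorem RO_dcell {ι : Type*} (J : Finset ι) (f : ι → Module.Dual ℝ W) (W0 : Submodule ℝ W)
    (S : Finset ι) : RO (dcell J f W0 S) := by
  have : dcell J f W0 S = (W0 : Set W) ∩ ⋂ i ∈ S, ((⋂ j ∈ S, {g | (f i - f j) g = 0}) ∩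
      ⋂ j ∈ J \ S, {g | 0 < (f j - f i) g}) := by
    ext g
    simp only [dcell, Set.mem_ofPred_eq, Set.mem_inter_iff, Set.mem_iInter, SetLike.mem_coe,
      LinearMap.sub_apply, sub_eq_zero, sub_pos, Finset.mem_sdiff]
    constructor
    · rintro ⟨h0, h1, h2⟩
      exact ⟨h0, fun i hi => ⟨h1 i hi, fun j hj => h2 i hi j hj.1 hj.2⟩⟩
    · rintro ⟨h0, h1⟩
      exact ⟨h0, fun i hi => (h1 i hi).1, fun i hi j hj hj' => (h1 i hi).2 j ⟨hj, hj'⟩⟩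
  rw [this]
  exact (RO.submodule W0).inter (RO.iInter _ _ fun i _ =>
    (RO.iInter _ _ fun j _ => RO.zero _).inter (RO.iInter _ _ fun j _ => RO.pos _))

variable [FiniteDimensional ℝ W]

theorem sum_dcell {ι : Type*} (J : Finset ι) (hJ : J.Nonempty) (f : ι → Module.Dual ℝ W)
    (W0 : Submodule ℝ W) :
    ∑ S ∈ J.powerset.erase ∅, eul (dcell J f W0 S) = eul (W0 : Set W) := by
  have hsub : ∀ S, (W0 : Set W) ∩ dcell J f W0 S = dcell J f W0 S :=
    fun S => Set.inter_eq_right.2 fun g hg => hg.1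
  rw [← eul_partition (J.powerset.erase ∅) (dcell J f W0) (fun S _ => RO_dcell J f W0 S)
    ((J ×ˢ J).toList.map fun p => f p.1 - f p.2) (W0 : Set W) (RO.submodule W0)]
  · simp only [hsub]
  · intro x hx
    refine ⟨J.filter fun j => ∀ k ∈ J, f j x ≤ f k x, ?_, hx, ?_, ?_⟩
    · obtain ⟨j, hj, h⟩ := J.exists_min_image (fun j => f j x) hJ
      rw [Finset.mem_erase, Finset.mem_powerset]
      exact ⟨Finset.nonempty_iff_ne_empty.1 ⟨j, by simp [hj]; exact h⟩, Finset.filter_subset _ _⟩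
    · intro i hi j hj
      simp only [Finset.mem_filter] at hi hj
      exact le_antisymm (hi.2 j hj.1) (hj.2 i hi.1)
    · intro i hi j hj hjn
      simp only [Finset.mem_filter, not_and, not_forall] at hi hjn
      obtain ⟨k, hk, h⟩ := hjn hj
      exact (hi.2 k hk).trans_lt (not_le.1 h)
  · intro x hx S hS S' hS' h h'
    simp only [Finset.mem_erase, Finset.mem_powerset] at hS hS'
    have key : ∀ S S' : Finset ι, S ≠ ∅ → S ⊆ J → S' ≠ ∅ → S' ⊆ J → x ∈ dcell J f W0 S →
        x ∈ dcell J f W0 S' → S ⊆ S' := by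
      intro S S' h1 h2 h3 h4 h h' i hi
      by_contra hn
      obtain ⟨i', hi'⟩ := Finset.nonempty_iff_ne_empty.2 h3
      have l1 := h'.2.2 i' hi' i (h2 hi) hn
      by_cases hc : i' ∈ S
      · exact l1.ne (h.2.1 i' hc i hi)
      · exact absurd (h.2.2 i hi i' (h4 hi') hc) l1.not_gt
    exact Finset.Subset.antisymm (key S S' hS.1 hS.2 hS'.1 hS'.2 h h')
      (key S' S hS'.1 hS'.2 hS.1 hS.2 h' h)
  · intro S hS x hx y hy hs h
    simp only [Finset.mem_erase, Finset.mem_powerset] at hS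
    have hs' : ∀ i ∈ J, ∀ j ∈ J, SignType.sign (f i x - f j x) = SignType.sign (f i y - f j y) := by
      intro i hi j hj
      have := hs (f i - f j) (by
        rw [List.mem_map]; exact ⟨(i, j), by simp [hi, hj], rfl⟩)
      simpa using this
    refine ⟨hy, fun i hi j hj => ?_, fun i hi j hj hn => ?_⟩
    · have := hs' i (hS.2 hi) j (hS.2 hj)
      rw [sub_eq_zero.2 (h.2.1 i hi j hj), sign_zero, eq_comm, sign_eq_zero_iff] at this
      linarith
    · have := hs' i (hS.2 hi) j hj
      rw [sign_neg (sub_neg.2 (h.2.2 i hi j hj hn)), eq_comm, sign_eq_neg_one_iff] at this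
      linarith

theorem cone_sum {ι : Type*} (J : Finset ι) (hJ : J.Nonempty) (a : ι → Module.Dual ℝ W)
    (W0 : Submodule ℝ W) (x0 : W) (hx0 : x0 ∈ W0) (hpos : ∀ j ∈ J, 0 < a j x0) :
    ∑ S ∈ J.powerset, eul (cell J a W0 S) = 0 := by
  set f : ι → Module.Dual ℝ W := fun j => (a j x0)⁻¹ • a j with hf
  have hf1 : ∀ j ∈ J, f j x0 = 1 := fun j hj => by
    simp [hf, inv_mul_cancel₀ (hpos j hj).ne']
  have hfz : ∀ j ∈ J, ∀ g, a j g = 0 ↔ f j g = 0 := fun j hj g => by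
    simp [hf, (hpos j hj).ne']
  have hfp : ∀ j ∈ J, ∀ g, 0 < a j g ↔ 0 < f j g := fun j hj g => by
    simp [hf, hpos j hj]
  rw [← Finset.add_sum_erase _ _ (Finset.empty_mem_powerset J)]
  have h0 : eul (cell J a W0 ∅) = eul (W0 : Set W) := by
    have e : cell J a W0 ∅ = (W0 : Set W) ∩ {g | ∀ j ∈ J, 0 < a j g} := by
      ext g; simp [cell]
    have hne : ((W0 : Set W) ∩ {g | ∀ j ∈ J, 0 < a j g}).Nonempty := ⟨x0, hx0, hpos⟩
    rw [e]
    exact eul_congr hne ⟨x0, hx0⟩ (vectorSpan_open J a (RO.submodule W0) hne).2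
  have h1 : ∀ S ∈ J.powerset.erase ∅, eul (cell J a W0 S) = - eul (dcell J f W0 S) := by
    intro S hS
    simp only [Finset.mem_erase, Finset.mem_powerset] at hS
    obtain ⟨i, hi⟩ := Finset.nonempty_iff_ne_empty.2 hS.1
    have e : cell J a W0 S = dcell J f W0 S ∩ {g | f i g = 0} := by
      ext g
      simp only [cell, dcell, Set.mem_inter_iff, Set.mem_ofPred_eq]
      constructor
      · rintro ⟨g0, g1, g2⟩
        have g1' : ∀ j ∈ S, f j g = 0 := fun j hj => (hfz j (hS.2 hj) g).1 (g1 j hj)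
        refine ⟨⟨g0, fun i hi j hj => by rw [g1' i hi, g1' j hj], fun i hi j hj hn => ?_⟩, g1' i hi⟩
        rw [g1' i hi]; exact (hfp j hj g).1 (g2 j hj hn)
      · rintro ⟨⟨g0, g1, g2⟩, g3⟩
        refine ⟨g0, fun j hj => (hfz j (hS.2 hj) g).2 ?_, fun j hj hn => (hfp j hj g).2 ?_⟩
        · rw [g1 j hj i hi, g3]
        · rw [← g3]; exact g2 i hi j hj hn
    rw [e]
    rcases Set.eq_empty_or_nonempty (dcell J f W0 S) with h | ⟨g, hg⟩
    · rw [h]; simp [eul_empty]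
    · have htr : ∀ t : ℝ, g + t • x0 ∈ dcell J f W0 S := by
        intro t
        refine ⟨W0.add_mem hg.1 (W0.smul_mem _ hx0), fun i hi j hj => ?_, fun i hi j hj hn => ?_⟩
        · simp [hf1 i (hS.2 hi), hf1 j (hS.2 hj), hg.2.1 i hi j hj]
        · simp [hf1 i (hS.2 hi), hf1 j hj, hg.2.2 i hi j hj hn]
      apply eul_section (RO_dcell J f W0 S)
      · exact ⟨_, htr (1 - f i g), by simp [hf1 i (hS.2 hi)]⟩
      · exact ⟨_, htr (-1 - f i g), by simp [hf1 i (hS.2 hi)]⟩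
  rw [h0, Finset.sum_congr rfl h1, Finset.sum_neg_distrib, sum_dcell J hJ f W0]
  ring

end Cone
section Poly

variable {n : ℕ}

/-- Functionals on the homogenization, vanishing on `s`. -/
noncomputable def ann (s : Set (EuclideanSpace ℝ (Fin n))) :
    Submodule ℝ (Module.Dual ℝ (EuclideanSpace ℝ (Fin n) × ℝ)) :=
  (Submodule.span ℝ ((fun x => ((x, 1) : EuclideanSpace ℝ (Fin n) × ℝ)) '' s)).dualAnnihilator

theorem mem_ann {s : Set (EuclideanSpace ℝ (Fin n))}
    {g : Module.Dual ℝ (EuclideanSpace ℝ (Fin n) × ℝ)} :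
    g ∈ ann s ↔ ∀ x ∈ s, g (x, 1) = 0 := by
  rw [ann, Submodule.mem_dualAnnihilator]
  constructor
  · intro h x hx
    exact h _ (Submodule.subset_span ⟨x, hx, rfl⟩)
  · intro h w hw
    have : Submodule.span ℝ ((fun x => ((x, 1) : EuclideanSpace ℝ (Fin n) × ℝ)) '' s) ≤
        LinearMap.ker g := by
      rw [Submodule.span_le]
      rintro _ ⟨x, hx, rfl⟩
      exact h x hx
    exact this hw

theorem finrank_hom (s : Set (EuclideanSpace ℝ (Fin n))) :
    (Module.finrank ℝ (Submodule.span ℝ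
      ((fun x => ((x, 1) : EuclideanSpace ℝ (Fin n) × ℝ)) '' s)) : ℤ) = fdim s + 1 := by
  rcases Set.eq_empty_or_nonempty s with rfl | ⟨x0, hx0⟩
  · simp [fdim]
  rw [fdim, if_neg (Set.nonempty_iff_ne_empty.1 ⟨x0, hx0⟩), direction_affineSpan]
  set U := Submodule.span ℝ ((fun x => ((x, 1) : EuclideanSpace ℝ (Fin n) × ℝ)) '' s) with hU
  have h1 := finrank_inf_ker U (LinearMap.snd ℝ (EuclideanSpace ℝ (Fin n)) ℝ)
    (u := (x0, 1)) (Submodule.subset_span ⟨x0, hx0, rfl⟩) (by simp)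
  have h2 : U ⊓ LinearMap.ker (LinearMap.snd ℝ (EuclideanSpace ℝ (Fin n)) ℝ) =
      (vectorSpan ℝ s).map (LinearMap.inl ℝ (EuclideanSpace ℝ (Fin n)) ℝ) := by
    apply le_antisymm
    · have key : ∀ w ∈ U, w - w.2 • (x0, (1:ℝ)) ∈
          (vectorSpan ℝ s).map (LinearMap.inl ℝ (EuclideanSpace ℝ (Fin n)) ℝ) := by
        intro w hw
        induction hw using Submodule.span_induction with
        | mem w hw =>
          obtain ⟨x, hx, rfl⟩ := hw
          exact ⟨x - x0, vsub_mem_vectorSpan ℝ hx hx0, by simp⟩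
        | zero => simp
        | add u v _ _ hu hv =>
          convert Submodule.add_mem _ hu hv using 1
          rw [Prod.snd_add]; module
        | smul c v _ hv =>
          convert Submodule.smul_mem _ c hv using 1
          rw [Prod.smul_snd, smul_eq_mul]; module
      rintro w ⟨hw, hw2⟩
      have hw2 : w.2 = 0 := hw2
      simpa [hw2] using key w hw
    · rw [Submodule.map_le_iff_le_comap, vectorSpan_eq_span_vsub_set_right ℝ hx0,
        Submodule.span_le]
      rintro _ ⟨x, hx, rfl⟩
      refine ⟨?_, by simp⟩
      have := U.sub_mem (Submodule.subset_span ⟨x, hx, rfl⟩)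
        (Submodule.subset_span ⟨x0, hx0, rfl⟩)
      simpa using this
  have h3 : Module.finrank ℝ ((vectorSpan ℝ s).map
      (LinearMap.inl ℝ (EuclideanSpace ℝ (Fin n)) ℝ)) = Module.finrank ℝ (vectorSpan ℝ s) :=
    LinearEquiv.finrank_eq (Submodule.equivMapOfInjective _ LinearMap.inl_injective _).symm
  rw [h1, h2, h3]
  push_cast; rfl

theorem finrank_ann (s : Set (EuclideanSpace ℝ (Fin n))) :
    (Module.finrank ℝ (ann s) : ℤ) = n - fdim s := by
  have h1 := finrank_hom s
  have h2 := Subspace.finrank_add_finrank_dualAnnihilator_eq (Submodule.span ℝ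
      ((fun x => ((x, 1) : EuclideanSpace ℝ (Fin n) × ℝ)) '' s))
  have h3 : Module.finrank ℝ (EuclideanSpace ℝ (Fin n) × ℝ) = n + 1 := by simp
  rw [h3] at h2
  rw [ann]
  omega

theorem face_fun {P s : Set (EuclideanSpace ℝ (Fin n))} (hs : IsExposed ℝ P s) :
    ∃ g : Module.Dual ℝ (EuclideanSpace ℝ (Fin n) × ℝ), (∀ x ∈ P, 0 ≤ g (x, 1)) ∧
      s = {x | x ∈ P ∧ g (x, 1) = 0} := by
  rcases Set.eq_empty_or_nonempty s with rfl | hne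
  · refine ⟨LinearMap.snd ℝ _ ℝ, by simp, by ext; simp⟩
  · obtain ⟨l, hl⟩ := hs hne
    obtain ⟨x0, hx0⟩ := hne
    have hx0' : x0 ∈ P ∧ ∀ y ∈ P, l y ≤ l x0 := by rw [hl] at hx0; exact hx0
    refine ⟨(l x0) • LinearMap.snd ℝ _ ℝ - l.toLinearMap ∘ₗ LinearMap.fst ℝ _ ℝ, ?_, ?_⟩
    · intro x hx
      simpa using hx0'.2 x hx
    · rw [hl]
      ext x
      simp only [Set.mem_ofPred_eq]
      refine and_congr_right fun hx => ?_
      simp only [LinearMap.sub_apply, LinearMap.smul_apply, LinearMap.snd_apply,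
        LinearMap.comp_apply, LinearMap.fst_apply, smul_eq_mul, mul_one]
      constructor
      · intro h
        have h1 := h x0 hx0'.1
        have h2 := hx0'.2 x hx
        exact sub_eq_zero.2 (le_antisymm h1 h2)
      · intro h y hy
        have h2 := hx0'.2 y hy
        have h3 : l x0 = l x := sub_eq_zero.1 h
        rwa [← h3]

theorem fun_face {P : Set (EuclideanSpace ℝ (Fin n))}
    (g : Module.Dual ℝ (EuclideanSpace ℝ (Fin n) × ℝ)) (hg : ∀ x ∈ P, 0 ≤ g (x, 1)) :
    IsExposed ℝ P {x | x ∈ P ∧ g (x, 1) = 0} := by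
  rintro ⟨x0, hx0, h0⟩
  refine ⟨-(LinearMap.toContinuousLinearMap (g ∘ₗ LinearMap.inl ℝ _ ℝ)), ?_⟩
  have hsplit : ∀ x : EuclideanSpace ℝ (Fin n), g (x, 1) = g (x, 0) + g (0, 1) := by
    intro x; rw [← map_add]; simp
  ext x
  simp only [Set.mem_ofPred_eq]
  refine and_congr_right fun hx => ?_
  simp only [neg_apply, LinearMap.coe_toContinuousLinearMap',
    LinearMap.comp_apply, LinearMap.inl_apply]
  constructor
  · intro h y hy
    have h1 := hg y hy
    rw [hsplit] at h h1
    linarith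
  · intro h
    have h1 := h x0 hx0
    have h2 := hg x hx
    rw [hsplit] at h0 h2 ⊢
    linarith

theorem hom_convex (g : Module.Dual ℝ (EuclideanSpace ℝ (Fin n) × ℝ)) :
    ∀ {x y : EuclideanSpace ℝ (Fin n)} {a b : ℝ}, a + b = 1 →
      g (a • x + b • y, 1) = a * g (x, 1) + b * g (y, 1) := by
  intro x y a b h
  rw [← smul_eq_mul, ← smul_eq_mul, ← map_smul, ← map_smul, ← map_add]
  simp [h]

theorem nonneg_of_vertices (V : Finset (EuclideanSpace ℝ (Fin n)))
    (g : Module.Dual ℝ (EuclideanSpace ℝ (Fin n) × ℝ)) (hg : ∀ v ∈ V, 0 ≤ g (v, 1)) :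
    ∀ x ∈ convexHull ℝ (V : Set (EuclideanSpace ℝ (Fin n))), 0 ≤ g (x, 1) := by
  have hc : Convex ℝ {x : EuclideanSpace ℝ (Fin n) | 0 ≤ g (x, 1)} := by
    intro x hx y hy a b ha hb hab
    simp only [Set.mem_ofPred_eq] at *
    rw [hom_convex g hab]; positivity
  exact fun x hx => convexHull_min (fun v hv => hg v hv) hc hx

theorem face_hull (V : Finset (EuclideanSpace ℝ (Fin n))) {s : Set (EuclideanSpace ℝ (Fin n))}
    (hs : IsExposed ℝ (convexHull ℝ (V : Set (EuclideanSpace ℝ (Fin n)))) s) :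
    s ⊆ convexHull ℝ {v | v ∈ V ∧ v ∈ s} := by
  obtain ⟨g, hg, hse⟩ := face_fun hs
  intro x hx
  have hx' := hx
  rw [hse] at hx'
  obtain ⟨hxP, hgx⟩ := hx'
  obtain ⟨w, hw0, hw1, hwx⟩ := Finset.mem_convexHull'.1 hxP
  have hsum : g (x, 1) = ∑ v ∈ V, w v * g (v, 1) := by
    have : ((x, 1) : EuclideanSpace ℝ (Fin n) × ℝ) = ∑ v ∈ V, w v • (v, (1:ℝ)) := by
      apply Prod.ext
      · simp [Prod.fst_sum, hwx]
      · simp [Prod.snd_sum, hw1]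
    rw [this, map_sum]; simp only [map_smul, smul_eq_mul]
  have hVP : ∀ v ∈ V, v ∈ convexHull ℝ (V : Set (EuclideanSpace ℝ (Fin n))) :=
    fun v hv => subset_convexHull ℝ _ hv
  have hz : ∀ v ∈ V, w v * g (v, 1) = 0 := by
    rw [hgx, eq_comm, Finset.sum_eq_zero_iff_of_nonneg] at hsum
    · exact hsum
    · exact fun v hv => mul_nonneg (hw0 v hv) (hg v (hVP v hv))
  have hz' : ∀ v ∈ V, w v ≠ 0 → v ∈ s := by
    intro v hv hne
    rw [hse]
    exact ⟨hVP v hv, (mul_eq_zero.1 (hz v hv)).resolve_left hne⟩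
  rw [← hwx, ← Finset.sum_filter_of_ne (p := fun v => w v ≠ 0)
    (fun v _ h h0 => h (by rw [h0, zero_smul]))]
  apply (convex_convexHull ℝ _).sum_mem
  · intro v hv
    exact hw0 v (Finset.mem_filter.1 hv).1
  · rw [Finset.sum_filter_of_ne (fun v _ h => h)]; exact hw1
  · intro v hv
    rw [Finset.mem_filter] at hv
    exact subset_convexHull ℝ _ ⟨hv.1, hz' v hv.1 hv.2⟩

theorem face_le (V : Finset (EuclideanSpace ℝ (Fin n))) {s t : Set (EuclideanSpace ℝ (Fin n))}
    (hs : IsExposed ℝ (convexHull ℝ (V : Set (EuclideanSpace ℝ (Fin n)))) s)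
    (ht : IsExposed ℝ (convexHull ℝ (V : Set (EuclideanSpace ℝ (Fin n)))) t)
    (h : ∀ v ∈ V, v ∈ s → v ∈ t) : s ⊆ t :=
  (face_hull V hs).trans (convexHull_min (fun v hv => h v hv.1 hv.2)
    (ht.convex (convex_convexHull ℝ _)))

theorem zero_on_face (V : Finset (EuclideanSpace ℝ (Fin n))) {s : Set (EuclideanSpace ℝ (Fin n))}
    (hs : IsExposed ℝ (convexHull ℝ (V : Set (EuclideanSpace ℝ (Fin n)))) s)
    (g : Module.Dual ℝ (EuclideanSpace ℝ (Fin n) × ℝ)) (h : ∀ v ∈ V, v ∈ s → g (v, 1) = 0) :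
    g ∈ ann s := by
  rw [mem_ann]
  have hc : Convex ℝ {x : EuclideanSpace ℝ (Fin n) | g (x, 1) = 0} := by
    intro x hx y hy a b ha hb hab
    simp only [Set.mem_ofPred_eq] at *
    rw [hom_convex g hab, hx, hy]; simp
  exact fun x hx => convexHull_min (fun v hv => h v hv.1 hv.2) hc (face_hull V hs hx)

theorem exists_big {ι : Type*} (V : Finset ι) (a b : ι → ℝ) :
    ∃ M : ℝ, ∀ v ∈ V, 0 < b v → 0 < a v + M * b v := by
  induction V using Finset.induction_on with
  | empty => exact ⟨0, by simp⟩
  | insert k V hk ih =>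
    obtain ⟨M, hM⟩ := ih
    refine ⟨max M ((1 - a k) / b k), fun v hv hb => ?_⟩
    rcases Finset.mem_insert.1 hv with rfl | hv
    · have := mul_le_mul_of_nonneg_right (le_max_right M ((1 - a v) / b v)) hb.le
      rw [div_mul_cancel₀ _ hb.ne'] at this
      linarith
    · have := mul_le_mul_of_nonneg_right (le_max_left M ((1 - a k) / b k)) hb.le
      linarith [hM v hv hb]

theorem euler_interval (V : Finset (EuclideanSpace ℝ (Fin n)))
    (P : Set (EuclideanSpace ℝ (Fin n))) (hP : P = convexHull ℝ (V : Set (EuclideanSpace ℝ (Fin n))))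
    [Fintype (Faces P)] (p q : Faces P) (hpq : p < q) :
    ∑ s : Faces P with p ≤ s ∧ s ≤ q, (-1 : ℝ) ^ ((n : ℤ) - fdim s.1) = 0 := by
  have hVP : ∀ v ∈ V, v ∈ P := fun v hv => by rw [hP]; exact subset_convexHull ℝ _ hv
  have hsubP : ∀ s : Faces P, s.1 ⊆ P := fun s => s.2.subset
  obtain ⟨gp, hgp, hpe⟩ := face_fun p.2
  obtain ⟨gq, hgq, hqe⟩ := face_fun q.2
  have hple : p.1 ⊆ q.1 := hpq.le
  set J : Finset (EuclideanSpace ℝ (Fin n)) := V.filter fun v => v ∈ q.1 ∧ v ∉ p.1 with hJdef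
  have hJmem : ∀ v, v ∈ J ↔ v ∈ V ∧ v ∈ q.1 ∧ v ∉ p.1 := fun v => by simp [hJdef]
  have hJ : J.Nonempty := by
    by_contra h
    apply hpq.not_ge
    refine face_le V (hP ▸ q.2) (hP ▸ p.2) fun v hv hvq => ?_
    by_contra hvp
    exact h ⟨v, (hJmem v).2 ⟨hv, hvq, hvp⟩⟩
  set a : EuclideanSpace ℝ (Fin n) →
      Module.Dual ℝ (Module.Dual ℝ (EuclideanSpace ℝ (Fin n) × ℝ)) :=
    fun v => Module.Dual.eval ℝ _ (v, 1) with ha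
  have hav : ∀ v g, a v g = g (v, 1) := fun v g => rfl
  have hmain := cone_sum J hJ a (ann p.1) gp (mem_ann.2 fun x hx => by
      rw [hpe] at hx; exact hx.2) (by
    intro v hv
    rw [hJmem] at hv
    rw [hav]
    refine lt_of_le_of_ne (hgp v (hVP v hv.1)) fun h => hv.2.2 ?_
    rw [hpe]; exact ⟨hVP v hv.1, h.symm⟩)
  rw [← hmain]
  refine Finset.sum_of_injOn (fun s : Faces P => J.filter fun v => v ∈ s.1) ?_ ?_ ?_ ?_
  · intro s hs t ht hst
    simp only [Finset.coe_filter, Finset.mem_univ, true_and, Set.mem_ofPred_eq] at hs ht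
    have key : ∀ s t : Faces P, p ≤ s → s ≤ q → p ≤ t →
        (J.filter fun v => v ∈ s.1) = (J.filter fun v => v ∈ t.1) → s ≤ t := by
      intro s t h1 h2 h3 he
      refine face_le V (hP ▸ s.2) (hP ▸ t.2) fun v hv hvs => ?_
      by_cases hvp : v ∈ p.1
      · exact h3 hvp
      · have : v ∈ J.filter fun v => v ∈ s.1 := by
          rw [Finset.mem_filter, hJmem]; exact ⟨⟨hv, h2 hvs, hvp⟩, hvs⟩
        rw [he, Finset.mem_filter] at this
        exact this.2
    exact le_antisymm (key s t hs.1 hs.2 ht.1 hst) (key t s ht.1 ht.2 hs.1 hst.symm)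
  · intro s _
    exact Finset.mem_coe.2 (Finset.mem_powerset.2 (Finset.filter_subset _ _))
  · intro S hS hnot
    rw [Finset.mem_powerset] at hS
    rcases Set.eq_empty_or_nonempty (cell J a (ann p.1) S) with h | ⟨g, hg0, hg1, hg2⟩
    · rw [h, eul_empty]
    exfalso
    apply hnot
    rw [mem_ann] at hg0
    simp only [hav] at hg1 hg2
    obtain ⟨M, hM⟩ := exists_big V (fun v => g (v, 1)) (fun v => gq (v, 1))
    set G := g + M • gq with hG
    have hGv : ∀ x, G (x, 1) = g (x, 1) + M * gq (x, 1) := fun x => by simp [hG]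
    have hqz : ∀ x ∈ q.1, gq (x, 1) = 0 := fun x hx => by rw [hqe] at hx; exact hx.2
    have hGq : ∀ x ∈ q.1, G (x, 1) = g (x, 1) := fun x hx => by rw [hGv, hqz x hx]; ring
    have hGout : ∀ v ∈ V, v ∉ q.1 → 0 < G (v, 1) := by
      intro v hv hvq
      rw [hGv]
      apply hM v hv
      refine lt_of_le_of_ne (hgq v (hVP v hv)) fun h => hvq ?_
      rw [hqe]; exact ⟨hVP v hv, h.symm⟩
    have hGnn : ∀ x ∈ P, 0 ≤ G (x, 1) := by
      rw [hP]
      apply nonneg_of_vertices V G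
      intro v hv
      by_cases hvq : v ∈ q.1
      · rw [hGq v hvq]
        by_cases hvp : v ∈ p.1
        · exact (hg0 v hvp).ge
        · by_cases hvS : v ∈ S
          · exact (hg1 v hvS).ge
          · exact (hg2 v ((hJmem v).2 ⟨hv, hvq, hvp⟩) hvS).le
      · exact (hGout v hv hvq).le
    have hexp := fun_face G hGnn
    refine ⟨⟨_, hexp⟩, ?_, ?_⟩
    · simp only [Finset.coe_filter, Finset.mem_univ, true_and, Set.mem_ofPred_eq]
      constructor
      · intro x hx
        exact ⟨hsubP p hx, by rw [hGq x (hple hx), hg0 x hx]⟩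
      · refine face_le V (hP ▸ hexp) (hP ▸ q.2) fun v hv hvs => ?_
        by_contra hvq
        exact (hGout v hv hvq).ne' hvs.2
    · ext v
      simp only [Finset.mem_filter, Set.mem_ofPred_eq]
      constructor
      · rintro ⟨hvJ, hvP, hz⟩
        by_contra hvS
        have := hg2 v hvJ hvS
        rw [hGq v ((hJmem v).1 hvJ).2.1] at hz
        exact this.ne' hz
      · intro hvS
        have hvJ := hS hvS
        refine ⟨hvJ, hVP v ((hJmem v).1 hvJ).1, ?_⟩
        rw [hGq v ((hJmem v).1 hvJ).2.1, hg1 v hvS]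
  · intro s hs
    simp only [Finset.mem_filter, Finset.mem_univ, true_and] at hs
    obtain ⟨hps, hsq⟩ := hs
    have hps' : p.1 ⊆ s.1 := hps
    have hsq' : s.1 ⊆ q.1 := hsq
    obtain ⟨gs, hgs, hse⟩ := face_fun s.2
    have e : cell J a (ann p.1) (J.filter fun v => v ∈ s.1) =
        (ann s.1 : Set _) ∩ {g | ∀ v ∈ J.filter (fun v => v ∉ s.1), 0 < a v g} := by
      ext g
      simp only [cell, Set.mem_ofPred_eq, Set.mem_inter_iff, SetLike.mem_coe, Finset.mem_filter]
      constructor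
      · rintro ⟨h0, h1, h2⟩
        rw [mem_ann] at h0
        refine ⟨zero_on_face V (hP ▸ s.2) g fun v hv hvs => ?_, fun v hv => h2 v hv.1 fun h => hv.2 h.2⟩
        by_cases hvp : v ∈ p.1
        · exact h0 v hvp
        · exact h1 v ⟨(hJmem v).2 ⟨hv, hsq' hvs, hvp⟩, hvs⟩
      · rintro ⟨h0, h1⟩
        rw [mem_ann] at h0
        refine ⟨mem_ann.2 fun x hx => h0 x (hps' hx), fun v hv => h0 v hv.2,
          fun v hv hn => h1 v ⟨hv, fun h => hn ⟨hv, h⟩⟩⟩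
    have hne : ((ann s.1 : Set _) ∩
        {g | ∀ v ∈ J.filter (fun v => v ∉ s.1), 0 < a v g}).Nonempty := by
      refine ⟨gs, mem_ann.2 fun x hx => by rw [hse] at hx; exact hx.2, fun v hv => ?_⟩
      rw [Finset.mem_filter, hJmem] at hv
      rw [hav]
      refine lt_of_le_of_ne (hgs v (hVP v hv.1.1)) fun h => hv.2 ?_
      rw [hse]; exact ⟨hVP v hv.1.1, h.symm⟩
    show _ = eul (cell J a (ann p.1) (J.filter fun v => v ∈ s.1))
    rw [e, eul, if_neg hne.ne_empty, (vectorSpan_open _ a (RO.submodule _) hne).2,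
      vectorSpan_submodule, ← finrank_ann s.1, zpow_natCast]

end Poly

theorem mobius_face_lattice {n : ℕ}
    (P : Set (EuclideanSpace ℝ (Fin n))) (hP : IsPolytope P) [Fintype (Faces P)]
    (μ : Faces P → Faces P → ℤ) (hμ : IsMobius μ)
    (p q : Faces P) (hpq : p ≤ q) :
    (μ p q : ℝ) = (-1 : ℝ) ^ (fdim q.1 - fdim p.1) := by
  obtain ⟨V, hV⟩ := hP
  obtain ⟨h1, h2, _⟩ := hμ
  induction q using WellFoundedLT.induction with
  | ind q ih =>
  rcases hpq.eq_or_lt with rfl | hlt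
  · simp [h1]
  have hE := euler_interval V P hV p q hlt
  have hsgn : ∀ s : Faces P, (-1 : ℝ) ^ (fdim s.1 - fdim p.1) =
      (-1 : ℝ) ^ ((n : ℤ) - fdim s.1) * (-1 : ℝ) ^ ((n : ℤ) - fdim p.1) := by
    intro s
    rw [← zpow_add₀ (by norm_num : (-1 : ℝ) ≠ 0)]
    have : (n : ℤ) - fdim s.1 + (n - fdim p.1) = (fdim s.1 - fdim p.1) + 2 * (n - fdim s.1) := by
      ring
    rw [this, zpow_add₀ (by norm_num : (-1 : ℝ) ≠ 0), zpow_mul]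
    norm_num
  have hE' : ∑ s : Faces P with p ≤ s ∧ s ≤ q, (-1 : ℝ) ^ (fdim s.1 - fdim p.1) = 0 := by
    simp only [hsgn]
    rw [← Finset.sum_mul, hE, zero_mul]
  have hset : (Finset.univ.filter fun s : Faces P => p ≤ s ∧ s ≤ q) =
      insert q (Finset.univ.filter fun s : Faces P => p ≤ s ∧ s < q) := by
    ext s
    simp only [Finset.mem_filter, Finset.mem_univ, true_and, Finset.mem_insert]
    constructor
    · rintro ⟨a, b⟩
      rcases b.eq_or_lt with b | b
      · exact Or.inl b
      · exact Or.inr ⟨a, b⟩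
    · rintro (rfl | ⟨a, b⟩)
      · exact ⟨hpq, le_rfl⟩
      · exact ⟨a, b.le⟩
  rw [hset, Finset.sum_insert (by simp)] at hE'
  rw [h2 p q hlt, ← Finset.sum_filter]
  push_cast
  rw [Finset.sum_congr rfl fun s hs => ih s (Finset.mem_filter.1 hs).2.2 (Finset.mem_filter.1 hs).2.1]
  linarith
end

section
/- The Möbius polynomial of the face lattice of the d-dimensional hypercube equals (3 - 2z)^d - z(2 - z)^d + 1. -/
open scoped Classical

/-- The d-dimensional hypercube [-1,1]^d. -/
def cube (d : ℕ) : Set (EuclideanSpace ℝ (Fin d)) :=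
  {x | ∀ i, x i ∈ Set.Icc (-1 : ℝ) 1}

namespace CubeAux

open Finset

variable {d : ℕ}

abbrev E (d : ℕ) := EuclideanSpace ℝ (Fin d)

def face (s : Fin d → SignType) : Set (E d) :=
  {x | x ∈ cube d ∧ ∀ i, s i ≠ 0 → x i = ((s i : SignType) : ℝ)}

noncomputable def ctr (s : Fin d → SignType) : E d :=
  WithLp.toLp 2 (fun i => ((s i : SignType) : ℝ))

lemma ctr_apply (s : Fin d → SignType) (i : Fin d) : ctr s i = ((s i : SignType) : ℝ) := rfl

lemma sign_mem (a : SignType) : ((a : SignType) : ℝ) ∈ Set.Icc (-1 : ℝ) 1 := by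
  cases a <;> simp

lemma sign_inj {a b : SignType} (h : ((a : SignType) : ℝ) = (b : ℝ)) : a = b := by
  revert h
  cases a <;> cases b <;> norm_num

lemma ctr_mem (s : Fin d → SignType) : ctr s ∈ face s :=
  ⟨fun i => sign_mem (s i), fun _ _ => rfl⟩

def le' (a b : SignType) : Prop := b = 0 ∨ a = b

instance (a b : SignType) : Decidable (le' a b) := by unfold le'; infer_instance

lemma face_subset {s t : Fin d → SignType} : face s ⊆ face t ↔ ∀ i, le' (s i) (t i) := by
  constructor
  · intro h i
    by_cases ht : t i = 0
    · exact Or.inl ht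
    · exact Or.inr (sign_inj ((h (ctr_mem s)).2 i ht))
  · intro h x hx
    refine ⟨hx.1, fun i hi => ?_⟩
    rcases h i with h | h
    · exact absurd h hi
    · rw [← h] at hi ⊢
      exact hx.2 i hi

lemma face_inj {s t : Fin d → SignType} (h : face s = face t) : s = t := by
  have h1 := face_subset.1 h.subset
  have h2 := face_subset.1 h.symm.subset
  funext i
  rcases h1 i with h | h
  · rcases h2 i with h' | h'
    · rw [h, h']
    · exact h'.symm
  · exact h

lemma mul_le_abs' (c y : ℝ) (hy : y ∈ Set.Icc (-1 : ℝ) 1) : c * y ≤ |c| := by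
  calc c * y ≤ |c * y| := le_abs_self _
    _ = |c| * |y| := abs_mul _ _
    _ ≤ |c| * 1 := by gcongr; exact abs_le.2 hy
    _ = |c| := mul_one _

lemma mul_sign (c : ℝ) : c * ((SignType.sign c : SignType) : ℝ) = |c| := by
  rw [mul_comm]; exact sign_mul_self c

lemma maxim (c : Fin d → ℝ) :
    {x | x ∈ cube d ∧ ∀ y ∈ cube d, ∑ i, c i * y i ≤ ∑ i, c i * x i}
      = face (fun i => SignType.sign (c i)) := by
  ext x
  constructor
  · rintro ⟨hx, hmax⟩
    refine ⟨hx, ?_⟩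
    have h1 := hmax _ (ctr_mem (fun i => SignType.sign (c i))).1
    simp only [ctr_apply, mul_sign] at h1
    have h2 : ∀ i ∈ univ, c i * x i ≤ |c i| := fun i _ => mul_le_abs' _ _ (hx i)
    have h3 := (Finset.sum_eq_sum_iff_of_le h2).1 (le_antisymm (Finset.sum_le_sum h2) h1)
    intro i hi
    have hc : c i ≠ 0 := by simpa using hi
    have := h3 i (mem_univ _)
    rw [← mul_sign] at this
    exact mul_left_cancel₀ hc this
  · rintro ⟨hx, h⟩
    refine ⟨hx, fun y hy => Finset.sum_le_sum fun i _ => ?_⟩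
    by_cases hc : c i = 0
    · simp [hc]
    · rw [h i (by simpa using hc), mul_sign]
      exact mul_le_abs' _ _ (hy i)

lemma lin_apply (l : StrongDual ℝ (E d)) (x : E d) :
    l x = ∑ i, l (EuclideanSpace.single i 1) * x i := by
  conv_lhs => rw [← (EuclideanSpace.basisFun (Fin d) ℝ).sum_repr x]
  simp [mul_comm]

lemma exposed_face (s : Fin d → SignType) : IsExposed ℝ (cube d) (face s) := by
  intro _
  refine ⟨∑ i, ((s i : SignType) : ℝ) • (EuclideanSpace.proj i : StrongDual ℝ (E d)), ?_⟩
  have := maxim (fun i => ((s i : SignType) : ℝ))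
  have h2 : (fun i => SignType.sign ((s i : SignType) : ℝ)) = s := by
    funext i
    cases s i <;> simp
  rw [h2] at this
  rw [← this]
  simp

lemma exists_face {F : Set (E d)} (hF : IsExposed ℝ (cube d) F) (hne : F.Nonempty) :
    ∃ s, F = face s := by
  obtain ⟨l, hl⟩ := hF hne
  refine ⟨fun i => SignType.sign (l (EuclideanSpace.single i 1)), ?_⟩
  rw [hl, ← maxim (fun i => l (EuclideanSpace.single i 1))]
  ext x
  refine and_congr_right fun _ => forall₂_congr fun y _ => ?_
  rw [lin_apply l x, lin_apply l y]

def toF : Option (Fin d → SignType) → Faces (cube d)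
  | none => ⟨∅, fun h => absurd h Set.not_nonempty_empty⟩
  | some s => ⟨face s, exposed_face s⟩

lemma toF_bij : Function.Bijective (toF (d := d)) := by
  constructor
  · rintro (_ | s) (_ | t) h
    · rfl
    · have : (∅ : Set (E d)) = face t := congrArg Subtype.val h
      exact absurd (this ▸ ctr_mem t) (Set.notMem_empty _)
    · have : face s = (∅ : Set (E d)) := congrArg Subtype.val h
      exact absurd (this ▸ ctr_mem s) (Set.notMem_empty _)
    · exact congrArg some (face_inj (congrArg Subtype.val h))
  · rintro ⟨F, hF⟩
    rcases F.eq_empty_or_nonempty with h | h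
    · exact ⟨none, Subtype.ext h.symm⟩
    · obtain ⟨s, hs⟩ := exists_face hF h
      exact ⟨some s, Subtype.ext hs.symm⟩

def lev : Option (Fin d → SignType) → Option (Fin d → SignType) → Prop
  | none, _ => True
  | some _, none => False
  | some s, some t => ∀ i, le' (s i) (t i)

lemma toF_le (p q : Option (Fin d → SignType)) : toF p ≤ toF q ↔ lev p q := by
  rcases p with _ | s <;> rcases q with _ | t
  · simp [lev]
  · simp only [lev, iff_true]
    exact Set.empty_subset _
  · simp only [lev, iff_false]
    intro h
    exact (Set.notMem_empty _) (h (ctr_mem s))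
  · exact face_subset

lemma fdim_face (s : Fin d → SignType) :
    fdim (face s) = ∑ i, (if s i = 0 then (1 : ℤ) else 0) := by
  have hne : face s ≠ ∅ := Set.Nonempty.ne_empty ⟨_, ctr_mem s⟩
  rw [fdim, if_neg hne, direction_affineSpan]
  set b : {i // s i = 0} → E d := fun i => EuclideanSpace.single i.1 (1 : ℝ) with hb
  have hli : LinearIndependent ℝ b := by
    have := (EuclideanSpace.basisFun (Fin d) ℝ).toBasis.linearIndependent.comp
      (fun i : {i // s i = 0} => i.1) Subtype.val_injective
    have hbe : b = (EuclideanSpace.basisFun (Fin d) ℝ).toBasis ∘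
        (fun i : {i // s i = 0} => i.1) := by
      funext i
      simp [hb]
    rw [hbe]
    exact this
  have hspan : vectorSpan ℝ (face s) = Submodule.span ℝ (Set.range b) := by
    apply le_antisymm
    · rw [vectorSpan_def, Submodule.span_le]
      rintro v ⟨x, hx, y, hy, rfl⟩
      simp only [vsub_eq_sub, SetLike.mem_coe]
      rw [← (EuclideanSpace.basisFun (Fin d) ℝ).sum_repr (x - y)]
      refine Submodule.sum_mem _ fun i _ => ?_
      by_cases hi : s i = 0
      · refine Submodule.smul_mem _ _ (Submodule.subset_span ⟨⟨i, hi⟩, ?_⟩)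
        simp [hb]
      · simp [hx.2 i hi, hy.2 i hi]
    · rw [Submodule.span_le]
      rintro _ ⟨⟨i, hi⟩, rfl⟩
      have hm : ctr s + EuclideanSpace.single i 1 ∈ face s := by
        constructor
        · intro j
          by_cases hj : j = i
          · subst hj
            simp [ctr_apply, hi]
          · simpa [hj, ctr_apply] using sign_mem (s j)
        · intro j hj
          have : j ≠ i := fun h => hj (h ▸ hi)
          simp [ctr_apply, this]
      have := vsub_mem_vectorSpan ℝ hm (ctr_mem s)
      simpa [hb] using this
  rw [hspan, finrank_span_eq_card hli, Fintype.card_subtype]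
  simp

def w (a b : SignType) : ℤ := if a = b then 1 else if b = 0 then -1 else 0
def v (b : SignType) : ℤ := if b = 0 then -1 else 1
def e (a b : SignType) : ℤ := if le' a b then 1 else 0

lemma w_e : ∀ a c, ∑ b, w a b * e b c = if a = c then 1 else 0 := by decide
lemma v_e : ∀ c, ∑ b, v b * e b c = 1 := by decide

def nu : Option (Fin d → SignType) → Option (Fin d → SignType) → ℤ
  | none, none => 1
  | none, some t => -∏ i, v (t i)
  | some _, none => 0
  | some s, some t => ∏ i, w (s i) (t i)

lemma prod_e (s t : Fin d → SignType) :
    ∏ i, e (s i) (t i) = if ∀ i, le' (s i) (t i) then 1 else 0 := by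
  split_ifs with h
  · exact Finset.prod_eq_one fun i _ => by simp [e, h i]
  · push Not at h
    obtain ⟨i, hi⟩ := h
    exact Finset.prod_eq_zero (mem_univ i) (by simp [e, hi])

lemma sum_prod {R : Type*} [CommRing R] (f : Fin d → SignType → R) :
    ∑ u : Fin d → SignType, ∏ i, f i (u i) = ∏ i, ∑ b, f i b := by
  rw [Finset.prod_univ_sum]
  simp

lemma nu_sum (p q : Option (Fin d → SignType)) :
    ∑ u, (if lev u q then nu p u else 0) = if p = q then 1 else 0 := by
  rw [Fintype.sum_option]
  rcases p with _ | s <;> rcases q with _ | t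
  · simp [lev, nu]
  · have : ∀ u : Fin d → SignType, (if lev (some u) (some t) then nu none (some u) else 0)
        = - ∏ i, (v (u i) * e (u i) (t i)) := by
      intro u
      rw [Finset.prod_mul_distrib, prod_e]
      by_cases hu : ∀ i, le' (u i) (t i)
      · have hl : lev (some u) (some t) := hu
        rw [if_pos hl, if_pos hu, mul_one]
        rfl
      · have hl : ¬ lev (some u) (some t) := hu
        rw [if_neg hl, if_neg hu]
        simp
    simp only [this, Finset.sum_neg_distrib]
    rw [sum_prod (fun i b => v b * e b (t i))]
    simp [v_e, lev, nu]
  · simp [lev, nu]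
  · have : ∀ u : Fin d → SignType, (if lev (some u) (some t) then nu (some s) (some u) else 0)
        = ∏ i, (w (s i) (u i) * e (u i) (t i)) := by
      intro u
      rw [Finset.prod_mul_distrib, prod_e]
      by_cases hu : ∀ i, le' (u i) (t i)
      · have hl : lev (some u) (some t) := hu
        rw [if_pos hl, if_pos hu, mul_one]
        rfl
      · have hl : ¬ lev (some u) (some t) := hu
        rw [if_neg hl, if_neg hu]
        simp
    simp only [this]
    rw [sum_prod (fun i b => w (s i) b * e b (t i))]
    simp only [w_e, nu, ite_self, zero_add, Option.some.injEq]
    split_ifs with h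
    · subst h; simp
    · obtain ⟨i, hi⟩ := Function.ne_iff.1 h
      exact Finset.prod_eq_zero (mem_univ i) (by simp [hi])

lemma w_zero {a b : SignType} (h : ¬ le' a b) : w a b = 0 := by
  revert h; revert a b; decide

lemma nu_zero {p q : Option (Fin d → SignType)} (h : ¬ lev p q) : nu p q = 0 := by
  rcases p with _ | s <;> rcases q with _ | t
  · simp [lev] at h
  · simp [lev] at h
  · rfl
  · simp only [lev] at h
    push Not at h
    obtain ⟨i, hi⟩ := h
    exact Finset.prod_eq_zero (mem_univ i) (w_zero hi)

lemma mu_eq [Fintype (Faces (cube d))]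
    (μ : Faces (cube d) → Faces (cube d) → ℤ) (hμ : IsMobius μ)
    (p q : Option (Fin d → SignType)) : μ (toF p) (toF q) = nu p q := by
  let N : Faces (cube d) → Faces (cube d) → ℤ := fun P Q =>
    nu ((Equiv.ofBijective _ toF_bij).symm P) ((Equiv.ofBijective _ toF_bij).symm Q)
  have hN : ∀ p q : Option (Fin d → SignType), N (toF p) (toF q) = nu p q := by
    intro p q
    simp only [N, Equiv.ofBijective_symm_apply_apply]
  have hsum : ∀ P Q, ∑ S, (if S ≤ Q then N P S else 0) = if P = Q then 1 else 0 := by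
    intro P Q
    obtain ⟨p, rfl⟩ := toF_bij.2 P
    obtain ⟨q, rfl⟩ := toF_bij.2 Q
    rw [← toF_bij.sum_comp]
    simp only [hN, toF_le, toF_bij.1.eq_iff]
    exact nu_sum p q
  have hz : ∀ P Q, ¬ P ≤ Q → N P Q = 0 := by
    intro P Q h
    obtain ⟨p, rfl⟩ := toF_bij.2 P
    obtain ⟨q, rfl⟩ := toF_bij.2 Q
    rw [toF_le] at h
    rw [hN, nu_zero h]
  have key : ∀ P Q, N P Q = (if P = Q then 1 else 0) - ∑ S, if P ≤ S ∧ S < Q then N P S else 0 := by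
    intro P Q
    rw [← hsum P Q, eq_sub_iff_add_eq]
    have : N P Q = ∑ S, if S = Q then N P S else 0 := by simp
    rw [this, ← Finset.sum_add_distrib]
    refine Finset.sum_congr rfl fun S _ => ?_
    by_cases h1 : S = Q
    · subst h1; simp
    · by_cases h2 : P ≤ S
      · simp [h1, h2, lt_iff_le_and_ne]
      · simp [h1, h2, hz P S h2]
  have main : ∀ P Q, μ P Q = N P Q := by
    intro P Q
    induction Q using (Finite.to_wellFoundedLT (α := Faces (cube d))).induction with
    | _ Q ih =>
      by_cases hle : P ≤ Q
      · rcases hle.eq_or_lt with h | h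
        · subst h
          rw [hμ.1, key, if_pos rfl, Finset.sum_eq_zero, sub_zero]
          intro S _
          exact if_neg fun h => absurd (h.1.trans_lt h.2) (lt_irrefl _)
        · rw [hμ.2.1 P Q h, key, if_neg h.ne, zero_sub]
          congr 1
          refine Finset.sum_congr rfl fun S _ => ?_
          split_ifs with hS
          · exact ih S hS.2
          · rfl
      · rw [hμ.2.2 P Q hle, hz P Q hle]
  rw [main, hN]

lemma term_ss (s t : Fin d → SignType) (z : ℝ) :
    (if lev (some s) (some t) then (nu (some s) (some t) : ℝ) *
      z ^ (fdim (face t) - fdim (face s)) else 0)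
      = ∏ i, ((w (s i) (t i) : ℝ) * z ^ (if s i = t i then 0 else 1)) := by
  split_ifs with h
  · have : fdim (face t) - fdim (face s) = ((∑ i, if s i = t i then 0 else 1 : ℕ) : ℤ) := by
      rw [fdim_face, fdim_face, ← Finset.sum_sub_distrib]
      push_cast
      refine Finset.sum_congr rfl fun i _ => ?_
      have hi := h i
      revert hi
      generalize s i = a
      generalize t i = b
      revert a b
      decide
    rw [this, zpow_natCast, Finset.prod_mul_distrib, Finset.prod_pow_eq_pow_sum]
    simp [nu]
  · simp only [lev] at h
    push Not at h
    obtain ⟨i, hi⟩ := h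
    exact (Finset.prod_eq_zero (mem_univ i) (by simp [w_zero hi])).symm

lemma term_ns (t : Fin d → SignType) (z : ℝ) :
    (nu none (some t) : ℝ) * z ^ (fdim (face t) - (-1))
      = -z * ∏ i, ((v (t i) : ℝ) * z ^ (if t i = 0 then 1 else 0)) := by
  have : fdim (face t) - (-1) = ((∑ i, (if t i = 0 then 1 else 0) + 1 : ℕ) : ℤ) := by
    rw [fdim_face]
    push_cast
    ring
  rw [this, zpow_natCast, Finset.prod_mul_distrib, Finset.prod_pow_eq_pow_sum]
  simp only [nu]
  push_cast
  ring

lemma sum_sign (f : SignType → ℝ) : ∑ b, f b = f 0 + f (-1) + f 1 := by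
  have : (univ : Finset SignType) = {0, -1, 1} := rfl
  rw [this]
  simp [add_assoc]

end CubeAux

open CubeAux in
theorem mobiusPoly_cube (d : ℕ) [Fintype (Faces (cube d))]
    (μ : Faces (cube d) → Faces (cube d) → ℤ) (hμ : IsMobius μ) (z : ℝ) :
    mobiusPoly μ (fun F => fdim F.1) z = (3 - 2 * z) ^ d - z * (2 - z) ^ d + 1 := by
  have hempty : fdim (toF (d := d) none).1 = -1 := by simp [fdim, toF]
  have hsome : ∀ s : Fin d → SignType, fdim (toF (some s)).1 = fdim (face s) := fun _ => rfl
  unfold mobiusPoly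
  rw [← toF_bij.sum_comp]
  simp only [← toF_bij.sum_comp, toF_le, mu_eq μ hμ]
  simp only [Fintype.sum_option, hempty, hsome, term_ss]
  have h1 : ∀ t : Fin d → SignType, lev none (some t) := fun _ => trivial
  have h2 : ∀ t : Fin d → SignType, ¬ lev (some t) none := fun _ h => h
  have h3 : lev (none : Option (Fin d → SignType)) none := trivial
  simp only [h1, h2, h3, if_true, if_false, term_ns, ← Finset.mul_sum, zero_add]
  rw [sum_prod (fun _ b => (v b : ℝ) * z ^ (if b = 0 then 1 else 0))]
  have h4 : ∀ s : Fin d → SignType,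
      ∑ t : Fin d → SignType, ∏ i, ((w (s i) (t i) : ℝ) * z ^ (if s i = t i then 0 else 1))
      = ∏ i, ∑ b, ((w (s i) b : ℝ) * z ^ (if s i = b then 0 else 1)) := fun s =>
    sum_prod (fun i b => (w (s i) b : ℝ) * z ^ (if s i = b then 0 else 1))
  simp only [h4]
  rw [sum_prod (fun _ a => ∑ b, ((w a b : ℝ) * z ^ (if a = b then 0 else 1)))]
  simp only [Finset.prod_const, Finset.card_univ, Fintype.card_fin, sum_sign]
  have e1 : (1 : SignType) ≠ 0 := by decide
  have e2 : (-1 : SignType) ≠ 0 := by decide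
  have e3 : (1 : SignType) ≠ -1 := by decide
  simp [w, v, nu, e1, e2, e3, e1.symm, e2.symm, e3.symm]
  ring
end
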